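/- The region 𝕂(X,Y) contains the origin (0,0,0) in its closure iff there exists a random variable Q with I(Q;Y|X)=0, I(Q;X|Y)=0, and I(X;Y|Q)=0; in that case (X,Y) can be written (up to relabeling by the component variable) so that X and Y are conditionally independent given a common part Q' computable from X alone and from Y alone. -/

import Mathlib

open Finset

open Classical in
/-- Probability that random variable `X` (on finite weighted space `p`) equals `a`. -/
noncomputable def prob {Ω α : Type*} [Fintype Ω] (p : Ω → ℝ) (X : Ω → α) (a : α) : ℝ :=
  ∑ ω, if X ω = a then p ω else 0

/-- Shannon entropy of a random variable. -/
noncomputable def ent {Ω α : Type*} [Fintype Ω] [Fintype α] (p : Ω → ℝ) (X : Ω → α) : ℝ :=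
  ∑ a, Real.negMulLog (prob p X a)

/-- Conditional entropy H(X|Y). -/
noncomputable def condEnt {Ω α β : Type*} [Fintype Ω] [Fintype α] [Fintype β]
    (p : Ω → ℝ) (X : Ω → α) (Y : Ω → β) : ℝ :=
  ent p (fun ω => (X ω, Y ω)) - ent p Y

/-- Mutual information I(X;Y). -/
noncomputable def mi {Ω α β : Type*} [Fintype Ω] [Fintype α] [Fintype β]
    (p : Ω → ℝ) (X : Ω → α) (Y : Ω → β) : ℝ :=
  ent p X + ent p Y - ent p (fun ω => (X ω, Y ω))

/-- Conditional mutual information I(X;Y|Z). -/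
noncomputable def cmi {Ω α β γ : Type*} [Fintype Ω] [Fintype α] [Fintype β] [Fintype γ]
    (p : Ω → ℝ) (X : Ω → α) (Y : Ω → β) (Z : Ω → γ) : ℝ :=
  ent p (fun ω => (X ω, Z ω)) + ent p (fun ω => (Y ω, Z ω))
    - ent p (fun ω => ((X ω, Y ω), Z ω)) - ent p Z

/-- `p` is a probability mass function. -/
def IsPMF {Ω : Type*} [Fintype Ω] (p : Ω → ℝ) : Prop :=
  (∀ ω, 0 ≤ p ω) ∧ ∑ ω, p ω = 1

/-- Bipartite graph on 𝒳 ⊔ 𝒴 with an edge between x and y iff the joint pmf μ(x,y) > 0. -/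
def edge {α β : Type*} (μ : α × β → ℝ) : α ⊕ β → α ⊕ β → Prop
  | Sum.inl x, Sum.inr y => 0 < μ (x, y)
  | Sum.inr y, Sum.inl x => 0 < μ (x, y)
  | _, _ => False


/-- Assisted-common-information region 𝕂 of a joint pmf μ on α × β: upward closure of
the triples (I(Q;B|A), I(Q;A|B), I(A;B|Q)) over all auxiliary finite random variables Q,
realized on the canonical space α × β × Fin m with (A,B)-marginal μ. -/
noncomputable def KRegion {α β : Type*} [Fintype α] [Fintype β] (μ : α × β → ℝ) :
    Set (ℝ × ℝ × ℝ) :=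
  { v | ∃ (m : ℕ) (ν : α × β × Fin m → ℝ),
      IsPMF ν ∧
      (∀ ab, prob ν (fun ω => (ω.1, ω.2.1)) ab = μ ab) ∧
      cmi ν (fun ω => ω.2.2) (fun ω => ω.2.1) (fun ω => ω.1) ≤ v.1 ∧
      cmi ν (fun ω => ω.2.2) (fun ω => ω.1) (fun ω => ω.2.1) ≤ v.2.1 ∧
      cmi ν (fun ω => ω.1) (fun ω => ω.2.1) (fun ω => ω.2.2) ≤ v.2.2 ∧
      0 ≤ v.1 ∧ 0 ≤ v.2.1 ∧ 0 ≤ v.2.2 }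


section Marginals
variable {α β κ : Type*} [Fintype α] [Fintype β] [Fintype κ] (ν : α × β × κ → ℝ)

theorem prob_fst_snd_thd (x : α) (y : β) (q : κ) :
    prob ν (fun ω => ((ω.1, ω.2.1), ω.2.2)) ((x, y), q) = ν (x, y, q) := by
  classical
  simp [prob, Fintype.sum_prod_type, ite_and]

theorem prob_thd_snd_fst (x : α) (y : β) (q : κ) :
    prob ν (fun ω => ((ω.2.2, ω.2.1), ω.1)) ((q, y), x) = ν (x, y, q) := by
  classical
  simp [prob, Fintype.sum_prod_type, ite_and]

theorem prob_thd_fst_snd (x : α) (y : β) (q : κ) :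
    prob ν (fun ω => ((ω.2.2, ω.1), ω.2.1)) ((q, x), y) = ν (x, y, q) := by
  classical
  simp [prob, Fintype.sum_prod_type, ite_and]

theorem prob_fst (x : α) :
    prob ν (fun ω => ω.1) x = ∑ y, ∑ q, ν (x, y, q) := by
  classical
  simp only [prob, Fintype.sum_prod_type]
  rw [Finset.sum_eq_single x] <;> simp +contextual

theorem prob_snd (y : β) :
    prob ν (fun ω => ω.2.1) y = ∑ x, ∑ q, ν (x, y, q) := by
  classical
  simp only [prob, Fintype.sum_prod_type]
  refine Finset.sum_congr rfl fun x _ => ?_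
  rw [Finset.sum_eq_single y] <;> simp +contextual

theorem prob_thd (q : κ) :
    prob ν (fun ω => ω.2.2) q = ∑ x, ∑ y, ν (x, y, q) := by
  classical
  simp [prob, Fintype.sum_prod_type]

theorem prob_fst_snd (x : α) (y : β) :
    prob ν (fun ω => (ω.1, ω.2.1)) (x, y) = ∑ q, ν (x, y, q) := by
  classical
  simp only [prob, Fintype.sum_prod_type, Prod.mk.injEq, ite_and]
  rw [Finset.sum_eq_single x, Finset.sum_eq_single y] <;> simp +contextual

theorem prob_snd_fst (x : α) (y : β) :
    prob ν (fun ω => (ω.2.1, ω.1)) (y, x) = ∑ q, ν (x, y, q) := by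
  classical
  simp only [prob, Fintype.sum_prod_type, Prod.mk.injEq, ite_and]
  rw [Finset.sum_eq_single x, Finset.sum_eq_single y] <;> simp +contextual

theorem prob_fst_thd (x : α) (q : κ) :
    prob ν (fun ω => (ω.1, ω.2.2)) (x, q) = ∑ y, ν (x, y, q) := by
  classical
  simp [prob, Fintype.sum_prod_type, ite_and]

theorem prob_thd_fst (x : α) (q : κ) :
    prob ν (fun ω => (ω.2.2, ω.1)) (q, x) = ∑ y, ν (x, y, q) := by
  classical
  simp only [prob, Fintype.sum_prod_type, Prod.mk.injEq, ite_and]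
  rw [Finset.sum_eq_single x] <;> simp +contextual

theorem prob_snd_thd (y : β) (q : κ) :
    prob ν (fun ω => (ω.2.1, ω.2.2)) (y, q) = ∑ x, ν (x, y, q) := by
  classical
  simp [prob, Fintype.sum_prod_type]

theorem prob_thd_snd (y : β) (q : κ) :
    prob ν (fun ω => (ω.2.2, ω.2.1)) (q, y) = ∑ x, ν (x, y, q) := by
  classical
  simp [prob, Fintype.sum_prod_type, ite_and]

end Marginals

/-- In a finite-dimensional space the convex hull of a compact set is compact. -/
theorem isCompact_convexHull_of_isCompact {E : Type*} [NormedAddCommGroup E] [NormedSpace ℝ E]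
    [FiniteDimensional ℝ E] {s : Set E} (hs : IsCompact s) : IsCompact (convexHull ℝ s) := by
  rcases s.eq_empty_or_nonempty with rfl | ⟨z₀, hz₀⟩
  · simp
  set N := Module.finrank ℝ E + 1
  have hK : IsCompact ((fun p : (Fin N → ℝ) × (Fin N → E) => ∑ i, p.1 i • p.2 i) ''
      (stdSimplex ℝ (Fin N) ×ˢ Set.univ.pi fun _ => s)) :=
    ((isCompact_stdSimplex ℝ (Fin N)).prod (isCompact_univ_pi fun _ => hs)).image (by fun_prop)
  convert hK using 1
  ext x
  constructor
  · intro hx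
    obtain ⟨ι, _, z, w, hz, hind, hw, hw1, rfl⟩ := eq_pos_convex_span_of_mem_convexHull hx
    have hcard : Fintype.card ι ≤ Fintype.card (Fin N) := by
      simpa [N] using hind.card_le_finrank_succ.trans
        (Nat.succ_le_succ (Submodule.finrank_le _))
    obtain ⟨e⟩ := Function.Embedding.nonempty_of_card_le hcard
    refine ⟨(Function.extend e w 0, Function.extend e z fun _ => z₀), ⟨⟨fun j => ?_, ?_⟩, ?_⟩, ?_⟩
    · by_cases h : ∃ i, e i = j
      · obtain ⟨i, rfl⟩ := h
        simpa [e.injective.extend_apply] using (hw i).le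
      · simp [Function.extend_apply' _ _ _ h]
    · rw [← hw1]
      exact (Fintype.sum_of_injective e e.injective _ _
        (fun j hj => Function.extend_apply' w (0 : Fin N → ℝ) j hj)
        fun i => (e.injective.extend_apply w (0 : Fin N → ℝ) i).symm).symm
    · intro j _
      by_cases h : ∃ i, e i = j
      · obtain ⟨i, rfl⟩ := h
        simpa [e.injective.extend_apply] using hz ⟨i, rfl⟩
      · simpa [Function.extend_apply' _ _ _ h] using hz₀
    · dsimp only
      refine (Fintype.sum_of_injective e e.injective _ _ (fun j hj => ?_) fun i => ?_).symm
      · rw [Function.extend_apply' _ _ _ hj, Pi.zero_apply, zero_smul]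
      · rw [e.injective.extend_apply, e.injective.extend_apply]
  · rintro ⟨p, ⟨hw, hz⟩, rfl⟩
    exact mem_convexHull_of_exists_fintype p.1 p.2 hw.1 hw.2 (fun i => hz i trivial) rfl

section Information
variable {Ω α β γ : Type*} [Fintype Ω]

theorem prob_nonneg {p : Ω → ℝ} (hp : ∀ ω, 0 ≤ p ω) (X : Ω → α) (a : α) : 0 ≤ prob p X a :=
  Finset.sum_nonneg fun ω _ => by split_ifs <;> simp [hp]

theorem prob_pos {p : Ω → ℝ} (hp : ∀ ω, 0 ≤ p ω) (X : Ω → α) {ω : Ω} (h : 0 < p ω) :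
    0 < prob p X (X ω) := by
  classical
  refine Finset.sum_pos' (fun ω _ => by split_ifs <;> simp [hp]) ⟨ω, mem_univ _, by simpa⟩

theorem sum_prob_mul [Fintype α] (p : Ω → ℝ) (X : Ω → α) (g : α → ℝ) :
    ∑ a, prob p X a * g a = ∑ ω, p ω * g (X ω) := by
  classical
  simp only [prob, Finset.sum_mul, ite_mul, zero_mul]
  rw [Finset.sum_comm]
  simp

theorem ent_eq_sum [Fintype α] (p : Ω → ℝ) (X : Ω → α) :
    ent p X = -∑ ω, p ω * Real.log (prob p X (X ω)) := by
  rw [← sum_prob_mul p X fun a => Real.log (prob p X a)]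
  simp [ent, Real.negMulLog]

theorem sum_prob_pair_left [Fintype α] (p : Ω → ℝ) (X : Ω → α) (Z : Ω → γ) (z : γ) :
    ∑ x, prob p (fun ω => (X ω, Z ω)) (x, z) = prob p Z z := by
  classical
  simp only [prob]
  rw [Finset.sum_comm]
  simp [ite_and]

theorem cmi_eq_sum [Fintype α] [Fintype β] [Fintype γ]
    (p : Ω → ℝ) (X : Ω → α) (Y : Ω → β) (Z : Ω → γ) :
    cmi p X Y Z = ∑ ω, p ω *
      (Real.log (prob p (fun ω => ((X ω, Y ω), Z ω)) ((X ω, Y ω), Z ω)) +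
        Real.log (prob p Z (Z ω)) - Real.log (prob p (fun ω => (X ω, Z ω)) (X ω, Z ω)) -
        Real.log (prob p (fun ω => (Y ω, Z ω)) (Y ω, Z ω))) := by
  simp only [cmi, ent_eq_sum, mul_add, mul_sub, Finset.sum_add_distrib, Finset.sum_sub_distrib]
  ring

theorem cmi_eq_zero_of_forall [Fintype α] [Fintype β] [Fintype γ]
    {p : Ω → ℝ} (hp : ∀ ω, 0 ≤ p ω) (X : Ω → α) (Y : Ω → β) (Z : Ω → γ)
    (h : ∀ ω, 0 < p ω →
      prob p (fun ω => ((X ω, Y ω), Z ω)) ((X ω, Y ω), Z ω) * prob p Z (Z ω) =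
        prob p (fun ω => (X ω, Z ω)) (X ω, Z ω) * prob p (fun ω => (Y ω, Z ω)) (Y ω, Z ω)) :
    cmi p X Y Z = 0 := by
  rw [cmi_eq_sum]
  refine Finset.sum_eq_zero fun ω _ => ?_
  rcases (hp ω).eq_or_lt with h0 | h0
  · simp [← h0]
  · have h1 := prob_pos hp (fun ω => ((X ω, Y ω), Z ω)) h0
    have h2 := prob_pos hp Z h0
    have h3 := prob_pos hp (fun ω => (X ω, Z ω)) h0
    have h4 := prob_pos hp (fun ω => (Y ω, Z ω)) h0
    rw [← Real.log_mul h1.ne' h2.ne', sub_sub, ← Real.log_mul h3.ne' h4.ne', h ω h0, sub_self,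
      mul_zero]

/-- The pointwise form of Gibbs' inequality, with its equality case. -/
theorem mul_log_sub_log_ge {a b : ℝ} (ha : 0 ≤ a) (hb : 0 ≤ b) (hab : 0 < a → 0 < b) :
    0 ≤ a * (Real.log a - Real.log b) - a + b ∧
      (a * (Real.log a - Real.log b) - a + b = 0 → a = b) := by
  rcases ha.eq_or_lt with rfl | ha
  · simpa using ⟨hb, fun h => h.symm⟩
  have hb := hab ha
  have hlog : Real.log (b / a) = Real.log b - Real.log a := Real.log_div hb.ne' ha.ne'
  have key : a * (b / a) = b := by field_simp
  constructor
  · have := Real.log_le_sub_one_of_pos (div_pos hb ha)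
    nlinarith
  · intro h
    by_contra hne
    have h1 : b / a ≠ 1 := fun h1 => hne (by rw [h1] at key; linarith)
    have := Real.log_lt_sub_one_of_pos (div_pos hb ha) h1
    nlinarith

theorem cmi_nonneg_and_eq_zero [Fintype α] [Fintype β] [Fintype γ]
    {p : Ω → ℝ} (hp : ∀ ω, 0 ≤ p ω) (X : Ω → α) (Y : Ω → β)
    (Z : Ω → γ) :
    0 ≤ cmi p X Y Z ∧ (cmi p X Y Z = 0 → ∀ x y z,
      prob p (fun ω => ((X ω, Y ω), Z ω)) ((x, y), z) * prob p Z z =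
        prob p (fun ω => (X ω, Z ω)) (x, z) * prob p (fun ω => (Y ω, Z ω)) (y, z)) := by
  classical
  set P := prob p (fun ω => ((X ω, Y ω), Z ω)) with hP
  set A := prob p (fun ω => (X ω, Z ω)) with hA
  set B := prob p (fun ω => (Y ω, Z ω)) with hB
  set C := prob p Z with hC
  have hP0 : ∀ t, 0 ≤ P t := prob_nonneg hp _
  have hA0 : ∀ t, 0 ≤ A t := prob_nonneg hp _
  have hB0 : ∀ t, 0 ≤ B t := prob_nonneg hp _
  have hC0 : ∀ t, 0 ≤ C t := prob_nonneg hp _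
  have hPA x y z : P ((x, y), z) ≤ A (x, z) := by
    refine Finset.sum_le_sum fun ω _ => ?_
    simp only [Prod.mk.injEq]
    have := hp ω
    split_ifs <;> simp_all
  have hPB x y z : P ((x, y), z) ≤ B (y, z) := by
    refine Finset.sum_le_sum fun ω _ => ?_
    simp only [Prod.mk.injEq]
    have := hp ω
    split_ifs <;> simp_all
  have hAC x z : A (x, z) ≤ C z := by
    refine Finset.sum_le_sum fun ω _ => ?_
    simp only [Prod.mk.injEq]
    have := hp ω
    split_ifs <;> simp_all
  set Q : (α × β) × γ → ℝ := fun t => A (t.1.1, t.2) * B (t.1.2, t.2) / C t.2 with hQ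
  have hQ0 t : 0 ≤ Q t := div_nonneg (mul_nonneg (hA0 _) (hB0 _)) (hC0 _)
  have hpos (t) (ht : 0 < P t) : 0 < A (t.1.1, t.2) ∧ 0 < B (t.1.2, t.2) ∧ 0 < C t.2 :=
    ⟨ht.trans_le (hPA _ _ _), ht.trans_le (hPB _ _ _),
      ht.trans_le ((hPA _ _ _).trans (hAC _ _))⟩
  have hsumP : ∑ t, P t = ∑ ω, p ω := by
    simpa using sum_prob_mul p (fun ω => ((X ω, Y ω), Z ω)) fun _ => 1
  have hsumQ : ∑ t, Q t = ∑ ω, p ω := by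
    have h1 : ∑ t, Q t = ∑ z, C z := by
      rw [Fintype.sum_prod_type, Finset.sum_comm]
      refine Finset.sum_congr rfl fun z _ => ?_
      rw [Fintype.sum_prod_type]
      simp only [hQ]
      simp only [← Finset.sum_div, ← Finset.mul_sum, ← Finset.sum_mul]
      rw [hA, hB, sum_prob_pair_left, sum_prob_pair_left, ← hC]
      exact mul_self_div_self _
    rw [h1]
    simpa using sum_prob_mul p Z fun _ => 1
  have hcmi : cmi p X Y Z = ∑ t, (P t * (Real.log (P t) - Real.log (Q t)) - P t + Q t) := by
    rw [Finset.sum_add_distrib, Finset.sum_sub_distrib, hsumP, hsumQ, sub_add_cancel,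
      cmi_eq_sum, ← sum_prob_mul p (fun ω => ((X ω, Y ω), Z ω)) fun t => Real.log (P t) +
        Real.log (C t.2) - Real.log (A (t.1.1, t.2)) - Real.log (B (t.1.2, t.2))]
    refine Finset.sum_congr rfl fun t _ => ?_
    rcases (hP0 t).eq_or_lt with h0 | h0
    · rw [← hP, ← h0]; simp
    · obtain ⟨h1, h2, h3⟩ := hpos t h0
      rw [hQ, Real.log_div (mul_pos h1 h2).ne' h3.ne', Real.log_mul h1.ne' h2.ne']
      ring
  have hterm t := mul_log_sub_log_ge (hP0 t) (hQ0 t) fun ht =>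
    let ⟨h1, h2, h3⟩ := hpos t ht
    div_pos (mul_pos h1 h2) h3
  rw [hcmi]
  refine ⟨Finset.sum_nonneg fun t _ => (hterm t).1, fun h x y z => ?_⟩
  rw [Finset.sum_eq_zero_iff_of_nonneg fun t _ => (hterm t).1] at h
  have := (hterm ((x, y), z)).2 (h _ (mem_univ _))
  rcases (hC0 z).eq_or_lt with h0 | h0
  · have : A (x, z) = 0 := le_antisymm (h0 ▸ hAC x z) (hA0 _)
    rw [← h0, this]; simp
  · rw [this, hQ]
    field_simp

end Information

section Region
variable {α β κ : Type*} [Fintype α] [Fintype β] [Fintype κ]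

/-- Unnormalised conditional entropy of the second coordinate given the first. -/
noncomputable def leftEnt (r : α × β → ℝ) : ℝ :=
  ∑ x, ∑ y, Real.negMulLog (r (x, y)) - ∑ x, Real.negMulLog (∑ y, r (x, y))

/-- Unnormalised conditional entropy of the first coordinate given the second. -/
noncomputable def rightEnt (r : α × β → ℝ) : ℝ :=
  ∑ x, ∑ y, Real.negMulLog (r (x, y)) - ∑ y, Real.negMulLog (∑ x, r (x, y))

/-- Unnormalised mutual information between the two coordinates. -/
noncomputable def jointInfo (r : α × β → ℝ) : ℝ :=
  ∑ x, Real.negMulLog (∑ y, r (x, y)) + ∑ y, Real.negMulLog (∑ x, r (x, y)) -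
    ∑ x, ∑ y, Real.negMulLog (r (x, y)) - Real.negMulLog (∑ x, ∑ y, r (x, y))

/-- A weight together with its three information functionals. -/
noncomputable def infoProfile (r : α × β → ℝ) : (α × β → ℝ) × ℝ × ℝ × ℝ :=
  (r, leftEnt r, rightEnt r, jointInfo r)

theorem continuous_infoProfile : Continuous (infoProfile : (α × β → ℝ) → _) := by
  unfold infoProfile leftEnt rightEnt jointInfo
  fun_prop

theorem infoProfile_smul (t : ℝ) (r : α × β → ℝ) : infoProfile (t • r) = t • infoProfile r := by
  have hcomm : ∑ y, ∑ x, r (x, y) = ∑ x, ∑ y, r (x, y) := Finset.sum_comm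
  simp only [infoProfile, leftEnt, rightEnt, jointInfo, Prod.smul_mk, Pi.smul_apply, smul_eq_mul,
    ← Finset.mul_sum, Real.negMulLog_mul, Finset.sum_add_distrib, ← Finset.sum_mul, hcomm]
  refine Prod.ext rfl (Prod.ext ?_ (Prod.ext ?_ ?_)) <;> dsimp only <;> ring

/-- The conditional weight of the first two coordinates at a value of the third. -/
def fiberWeight (ν : α × β × κ → ℝ) (q : κ) : α × β → ℝ := fun ab => ν (ab.1, ab.2, q)

theorem sum_infoProfile_fiber {ν : α × β × κ → ℝ} {μ : α × β → ℝ}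
    (hμ : ∀ ab, prob ν (fun ω => (ω.1, ω.2.1)) ab = μ ab) :
    ∑ q, infoProfile (fiberWeight ν q) =
      (μ, leftEnt μ - cmi ν (fun ω => ω.2.2) (fun ω => ω.2.1) (fun ω => ω.1),
        rightEnt μ - cmi ν (fun ω => ω.2.2) (fun ω => ω.1) (fun ω => ω.2.1),
        cmi ν (fun ω => ω.1) (fun ω => ω.2.1) (fun ω => ω.2.2)) := by
  have hμ' x y : μ (x, y) = ∑ q, ν (x, y, q) := by rw [← hμ, prob_fst_snd]
  have hl : ∑ q, (infoProfile (fiberWeight ν q)).2.1 =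
      leftEnt μ - cmi ν (fun ω => ω.2.2) (fun ω => ω.2.1) (fun ω => ω.1) := by
    have h₁ : ∑ q, ∑ y, ∑ x, Real.negMulLog (ν (x, y, q)) =
        ∑ q, ∑ x, ∑ y, Real.negMulLog (ν (x, y, q)) :=
      Finset.sum_congr rfl fun q _ => Finset.sum_comm
    have h₂ : ∑ y, ∑ x, Real.negMulLog (∑ q, ν (x, y, q)) =
        ∑ x, ∑ y, Real.negMulLog (∑ q, ν (x, y, q)) := Finset.sum_comm
    have h₃ x : ∑ y, ∑ q, ν (x, y, q) = ∑ q, ∑ y, ν (x, y, q) := Finset.sum_comm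
    simp only [infoProfile, leftEnt, fiberWeight, hμ', cmi, ent, Fintype.sum_prod_type,
      prob_thd_fst, prob_snd_fst, prob_thd_snd_fst, prob_fst, Finset.sum_sub_distrib, h₁, h₂, h₃]
    ring
  have hr : ∑ q, (infoProfile (fiberWeight ν q)).2.2.1 =
      rightEnt μ - cmi ν (fun ω => ω.2.2) (fun ω => ω.1) (fun ω => ω.2.1) := by
    simp only [infoProfile, rightEnt, fiberWeight, hμ', cmi, ent, Fintype.sum_prod_type,
      prob_thd_snd, prob_fst_snd, prob_thd_fst_snd, prob_snd, Finset.sum_sub_distrib]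
    ring
  have hi : ∑ q, (infoProfile (fiberWeight ν q)).2.2.2 =
      cmi ν (fun ω => ω.1) (fun ω => ω.2.1) (fun ω => ω.2.2) := by
    have h₁ : ∑ x, ∑ q, Real.negMulLog (∑ y, ν (x, y, q)) =
        ∑ q, ∑ x, Real.negMulLog (∑ y, ν (x, y, q)) := Finset.sum_comm
    have h₂ : ∑ y, ∑ q, Real.negMulLog (∑ x, ν (x, y, q)) =
        ∑ q, ∑ y, Real.negMulLog (∑ x, ν (x, y, q)) := Finset.sum_comm
    have h₃ : ∑ x, ∑ y, ∑ q, Real.negMulLog (ν (x, y, q)) =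
        ∑ q, ∑ x, ∑ y, Real.negMulLog (ν (x, y, q)) :=
      (Finset.sum_congr rfl fun x _ => Finset.sum_comm).trans Finset.sum_comm
    simp only [infoProfile, jointInfo, fiberWeight, cmi, ent, Fintype.sum_prod_type,
      prob_fst_thd, prob_snd_thd, prob_fst_snd_thd, prob_thd, Finset.sum_sub_distrib,
      Finset.sum_add_distrib, h₁, h₂, h₃]
  rw [← hl, ← hr, ← hi]
  refine Prod.ext ?_ (Prod.ext ?_ (Prod.ext ?_ ?_))
  · ext ab
    simp only [Prod.fst_sum, Finset.sum_apply, hμ']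
    rfl
  all_goals simp only [Prod.fst_sum, Prod.snd_sum]

theorem infoProfile_mem_convexHull {ν : α × β × κ → ℝ} (hν : IsPMF ν) :
    ∑ q, infoProfile (fiberWeight ν q) ∈ convexHull ℝ (infoProfile '' stdSimplex ℝ (α × β)) := by
  classical
  have hsum : ∑ q, ∑ ab, fiberWeight ν q ab = 1 := by
    rw [← hν.2, Finset.sum_comm]
    simp only [Fintype.sum_prod_type, fiberWeight]
  have hnn q ab : 0 ≤ fiberWeight ν q ab := hν.1 _
  have hne : (stdSimplex ℝ (α × β)).Nonempty := by
    refine ⟨fun ab => ∑ q, fiberWeight ν q ab, fun ab => Finset.sum_nonneg fun q _ => hnn q ab, ?_⟩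
    rw [Finset.sum_comm, hsum]
  obtain ⟨r₀, hr₀⟩ := hne
  set w : κ → ℝ := fun q => ∑ ab, fiberWeight ν q ab with hw
  have hw0 q : 0 ≤ w q := Finset.sum_nonneg fun ab _ => hnn q ab
  refine mem_convexHull_of_exists_fintype w
    (fun q => infoProfile (if w q = 0 then r₀ else (w q)⁻¹ • fiberWeight ν q)) hw0 hsum
    (fun q => Set.mem_image_of_mem _ ?_) (Finset.sum_congr rfl fun q _ => ?_)
  · split_ifs with h
    · exact hr₀
    · refine ⟨fun ab => mul_nonneg (inv_nonneg.2 (hw0 q)) (hnn q ab), ?_⟩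
      simp only [Pi.smul_apply, smul_eq_mul, ← Finset.mul_sum]
      exact inv_mul_cancel₀ h
  · rw [← infoProfile_smul]
    split_ifs with h
    · congr 1
      rw [h, zero_smul]
      ext ab
      exact ((Finset.sum_eq_zero_iff_of_nonneg fun ab _ => hnn q ab).1 h ab (mem_univ _)).symm
    · rw [smul_smul, mul_inv_cancel₀ h, one_smul]

theorem profile_mem_convexHull_of_mem_closure {μ : α × β → ℝ}
    (h : ((0 : ℝ), (0 : ℝ), (0 : ℝ)) ∈ closure (KRegion μ)) :
    (μ, leftEnt μ, rightEnt μ, (0 : ℝ)) ∈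
      convexHull ℝ (infoProfile '' stdSimplex ℝ (α × β)) := by
  have hcl : IsClosed (convexHull ℝ (infoProfile '' stdSimplex ℝ (α × β))) :=
    (isCompact_convexHull_of_isCompact
      ((isCompact_stdSimplex ℝ (α × β)).image continuous_infoProfile)).isClosed
  rw [← hcl.closure_eq, Metric.mem_closure_iff]
  intro ε hε
  obtain ⟨v, ⟨m, ν, hν, hμ, h1, h2, h3, -⟩, hv⟩ := Metric.mem_closure_iff.1 h ε hε
  refine ⟨_, infoProfile_mem_convexHull hν, ?_⟩
  rw [sum_infoProfile_fiber hμ]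
  have n1 := (cmi_nonneg_and_eq_zero hν.1 (fun ω => ω.2.2) (fun ω => ω.2.1) (fun ω => ω.1)).1
  have n2 := (cmi_nonneg_and_eq_zero hν.1 (fun ω => ω.2.2) (fun ω => ω.1) (fun ω => ω.2.1)).1
  have n3 := (cmi_nonneg_and_eq_zero hν.1 (fun ω => ω.1) (fun ω => ω.2.1) (fun ω => ω.2.2)).1
  simp only [Prod.dist_eq, Real.dist_eq, max_lt_iff, dist_self, abs_lt] at hv ⊢
  obtain ⟨⟨a1, a2⟩, ⟨b1, b2⟩, c1, c2⟩ := hv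
  refine ⟨hε, ⟨?_, ?_⟩, ⟨?_, ?_⟩, ?_, ?_⟩ <;> linarith

/-- The region is closed at the origin: if the origin is a limit point, it is attained. -/
theorem exists_of_mem_closure {μ : α × β → ℝ} (hμ : IsPMF μ)
    (h : ((0 : ℝ), (0 : ℝ), (0 : ℝ)) ∈ closure (KRegion μ)) :
    ∃ (m : ℕ) (ν : α × β × Fin m → ℝ),
      IsPMF ν ∧
      (∀ ab, prob ν (fun ω => (ω.1, ω.2.1)) ab = μ ab) ∧
      cmi ν (fun ω => ω.2.2) (fun ω => ω.2.1) (fun ω => ω.1) = 0 ∧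
      cmi ν (fun ω => ω.2.2) (fun ω => ω.1) (fun ω => ω.2.1) = 0 ∧
      cmi ν (fun ω => ω.1) (fun ω => ω.2.1) (fun ω => ω.2.2) = 0 := by
  obtain ⟨ι, _, w, z, hw, hw1, hz, hsum⟩ :=
    mem_convexHull_iff_exists_fintype.1 (profile_mem_convexHull_of_mem_closure h)
  choose r hr hrz using hz
  let e := Fintype.equivFin ι
  let ν : α × β × Fin (Fintype.card ι) → ℝ :=
    fun t => w (e.symm t.2.2) * r (e.symm t.2.2) (t.1, t.2.1)
  have hfib q : fiberWeight ν q = w (e.symm q) • r (e.symm q) := rfl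
  have hprof : ∑ q, infoProfile (fiberWeight ν q) = (μ, leftEnt μ, rightEnt μ, (0 : ℝ)) := by
    rw [← hsum]
    simp only [hfib, infoProfile_smul, hrz]
    exact e.symm.sum_comp fun i => w i • z i
  have hmarg ab : prob ν (fun ω => (ω.1, ω.2.1)) ab = μ ab := by
    have := congrFun (congrArg Prod.fst hprof) ab
    rw [Prod.fst_sum, Finset.sum_apply] at this
    exact (prob_fst_snd ν ab.1 ab.2).trans this
  have hν : IsPMF ν := by
    refine ⟨fun t => mul_nonneg (hw _) ((hr _).1 _), ?_⟩
    rw [← hμ.2]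
    simpa [hmarg] using (sum_prob_mul ν (fun ω => (ω.1, ω.2.1)) fun _ => 1).symm
  rw [sum_infoProfile_fiber hmarg] at hprof
  simp only [Prod.mk.injEq, sub_eq_self, true_and] at hprof
  exact ⟨_, ν, hν, hmarg, hprof⟩

end Region

section DoubleMarkov
variable {α β γ κ : Type*} [Fintype α] [Fintype β] [Fintype κ]

/-- If an auxiliary variable is conditionally independent of each coordinate given the other and
makes the coordinates conditionally independent, then within every connected component of the
support graph the joint weight is a product. -/
theorem mul_component_mass_eq {ν : α × β × κ → ℝ} (hν : ∀ t, 0 ≤ ν t)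
    {f : α ⊕ β → γ} {μ : α × β → ℝ} (hμν : ∀ x y, μ (x, y) = ∑ q, ν (x, y, q))
    (hf : ∀ a b, f a = f b ↔ Relation.EqvGen (edge μ) a b)
    (hl : ∀ x y q, ν (x, y, q) * ∑ y', μ (x, y') = (∑ y', ν (x, y', q)) * μ (x, y))
    (hr : ∀ x y q, ν (x, y, q) * ∑ x', μ (x', y) = (∑ x', ν (x', y, q)) * μ (x, y))
    (hi : ∀ x y q, ν (x, y, q) * ∑ x', ∑ y', ν (x', y', q) =
      (∑ y', ν (x, y', q)) * ∑ x', ν (x', y, q))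
    {x : α} {y : β} (hxy : 0 < μ (x, y)) [DecidableEq γ] :
    μ (x, y) * (∑ x', if f (Sum.inl x') = f (Sum.inl x) then ∑ y', μ (x', y') else 0) =
      (∑ y', μ (x, y')) * ∑ x', μ (x', y) := by
  have hμ0 t : 0 ≤ μ t := by
    rw [show t = (t.1, t.2) from rfl, hμν]; exact Finset.sum_nonneg fun q _ => hν _
  obtain ⟨q, -, hq⟩ : ∃ q ∈ univ, 0 < ν (x, y, q) := by
    by_contra! h
    rw [hμν] at hxy
    exact hxy.not_ge (Finset.sum_nonpos h)
  have hX {x y} (h : 0 < μ (x, y)) : 0 < ∑ y', μ (x, y') :=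
    h.trans_le (Finset.single_le_sum (f := fun y' => μ (x, y')) (fun _ _ => hμ0 _) (mem_univ y))
  have hY {x y} (h : 0 < μ (x, y)) : 0 < ∑ x', μ (x', y) :=
    h.trans_le (Finset.single_le_sum (f := fun x' => μ (x', y)) (fun _ _ => hμ0 _) (mem_univ x))
  -- the conditional weight of `q` given a vertex
  let k : α ⊕ β → ℝ := Sum.elim (fun x => (∑ y', ν (x, y', q)) / ∑ y', μ (x, y'))
    (fun y => (∑ x', ν (x', y, q)) / ∑ x', μ (x', y))
  have hkl {x y} (h : 0 < μ (x, y)) : k (Sum.inl x) = ν (x, y, q) / μ (x, y) := by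
    simp only [k, Sum.elim_inl]
    rw [div_eq_div_iff (hX h).ne' h.ne', hl]
  have hkr {x y} (h : 0 < μ (x, y)) : k (Sum.inr y) = ν (x, y, q) / μ (x, y) := by
    simp only [k, Sum.elim_inr]
    rw [div_eq_div_iff (hY h).ne' h.ne', hr]
  have hkf a b (hab : f a = f b) : k a = k b := by
    rw [hf] at hab
    induction hab with
    | rel a b h =>
      rcases a with a | a <;> rcases b with b | b
      · exact h.elim
      · exact (hkl h).trans (hkr h).symm
      · exact (hkr h).trans (hkl h).symm
      · exact h.elim
    | refl => rfl
    | symm a b _ ih => exact ih.symm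
    | trans a b c _ _ ih₁ ih₂ => exact ih₁.trans ih₂
  set c := k (Sum.inl x) with hc
  have hc0 : 0 < c := by rw [hc, hkl hxy]; exact div_pos hq hxy
  have hfxy : f (Sum.inl x) = f (Sum.inr y) := (hf _ _).2 (.rel _ _ hxy)
  have hνxy : ν (x, y, q) = c * μ (x, y) := by rw [hc, hkl hxy, div_mul_cancel₀ _ hxy.ne']
  have hνX : ∑ y', ν (x, y', q) = c * ∑ y', μ (x, y') := (div_mul_cancel₀ _ (hX hxy).ne').symm
  have hνY : ∑ x', ν (x', y, q) = c * ∑ x', μ (x', y) := by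
    rw [hc, hkf _ _ hfxy]; exact (div_mul_cancel₀ _ (hY hxy).ne').symm
  have hνle x y : ν (x, y, q) ≤ μ (x, y) := by
    rw [hμν]; exact Finset.single_le_sum (f := fun q => ν (x, y, q)) (fun _ _ => hν _) (mem_univ q)
  have hmass : ∑ x', ∑ y', ν (x', y', q) =
      c * ∑ x', if f (Sum.inl x') = f (Sum.inl x) then ∑ y', μ (x', y') else 0 := by
    rw [Finset.mul_sum]
    refine Finset.sum_congr rfl fun x' _ => ?_
    split_ifs with h
    · rcases (Finset.sum_nonneg fun y' (_ : y' ∈ univ) => hμ0 (x', y')).eq_or_lt with h0 | h0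
      · rw [← h0, mul_zero]
        refine le_antisymm ?_ (Finset.sum_nonneg fun _ _ => hν _)
        rw [h0]
        exact Finset.sum_le_sum fun y' _ => hνle x' y'
      · rw [hc, ← hkf _ _ h]; exact (div_mul_cancel₀ _ h0.ne').symm
    · have hz : ν (x', y, q) = 0 := by
        refine le_antisymm ((hνle x' y).trans (not_lt.1 fun hlt => h ?_)) (hν _)
        exact ((hf _ _).2 (.rel (Sum.inl x') (Sum.inr y) hlt)).trans hfxy.symm
      have := hi x' y q
      rw [hz, zero_mul, hνY] at this
      rw [mul_zero]
      exact (mul_eq_zero.1 this.symm).resolve_right (mul_pos hc0 (hY hxy)).ne'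
  have := hi x y q
  rw [hνxy, hmass, hνX, hνY] at this
  refine mul_left_cancel₀ (mul_pos hc0 hc0).ne' ?_
  linear_combination this

theorem cmi_component_eq_zero [Fintype γ] {μ : α × β → ℝ} (hμ : IsPMF μ)
    {f : α ⊕ β → γ} (hf : ∀ a b, f a = f b ↔ Relation.EqvGen (edge μ) a b)
    {ν : α × β × κ → ℝ} (hν : IsPMF ν)
    (hμν : ∀ ab, prob ν (fun ω => (ω.1, ω.2.1)) ab = μ ab)
    (hl : cmi ν (fun ω => ω.2.2) (fun ω => ω.2.1) (fun ω => ω.1) = 0)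
    (hr : cmi ν (fun ω => ω.2.2) (fun ω => ω.1) (fun ω => ω.2.1) = 0)
    (hi : cmi ν (fun ω => ω.1) (fun ω => ω.2.1) (fun ω => ω.2.2) = 0) :
    cmi μ (fun ω => ω.1) (fun ω => ω.2) (fun ω => f (Sum.inl ω.1)) = 0 := by
  classical
  have hμ' x y : μ (x, y) = ∑ q, ν (x, y, q) := by rw [← hμν, prob_fst_snd]
  have hl := (cmi_nonneg_and_eq_zero hν.1 _ _ _).2 hl
  have hr := (cmi_nonneg_and_eq_zero hν.1 _ _ _).2 hr
  have hi := (cmi_nonneg_and_eq_zero hν.1 _ _ _).2 hi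
  simp only [prob_thd_snd_fst, prob_fst, prob_thd_fst, prob_snd_fst, ← hμ'] at hl
  simp only [prob_thd_fst_snd, prob_snd, prob_thd_snd, prob_fst_snd, ← hμ'] at hr
  simp only [prob_fst_snd_thd, prob_thd, prob_fst_thd, prob_snd_thd] at hi
  refine cmi_eq_zero_of_forall hμ.1 _ _ _ ?_
  rintro ⟨x, y⟩ hxy
  have key := mul_component_mass_eq hν.1 hμ' hf (fun x y q => hl q y x) (fun x y q => hr q x y)
    hi hxy
  have hfxy : f (Sum.inl x) = f (Sum.inr y) := (hf _ _).2 (.rel _ _ hxy)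
  have p1 : prob μ (fun ω => ((ω.1, ω.2), f (Sum.inl ω.1))) ((x, y), f (Sum.inl x)) =
      μ (x, y) := by
    rw [prob, Finset.sum_eq_single (x, y)] <;> simp +contextual
  have p2 : prob μ (fun ω => f (Sum.inl ω.1)) (f (Sum.inl x)) =
      ∑ x', if f (Sum.inl x') = f (Sum.inl x) then ∑ y', μ (x', y') else 0 := by
    simp only [prob, Fintype.sum_prod_type]
    refine Finset.sum_congr rfl fun x' _ => ?_
    split_ifs <;> simp
  have p3 : prob μ (fun ω => (ω.1, f (Sum.inl ω.1))) (x, f (Sum.inl x)) = ∑ y', μ (x, y') := by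
    simp only [prob, Fintype.sum_prod_type]
    rw [Finset.sum_eq_single x] <;> simp +contextual
  have p4 : prob μ (fun ω => (ω.2, f (Sum.inl ω.1))) (y, f (Sum.inl x)) = ∑ x', μ (x', y) := by
    simp only [prob, Fintype.sum_prod_type]
    refine Finset.sum_congr rfl fun x' _ => ?_
    rw [Finset.sum_eq_single y]
    · split_ifs with h
      · rfl
      · refine le_antisymm (hμ.1 _) (not_lt.1 fun hlt => h ?_)
        rw [(hf _ _).2 (.rel (Sum.inl x') (Sum.inr y) hlt), hfxy]
    · simp +contextual
    · simp
  dsimp only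
  rw [p1, p2, p3, p4, key]

end DoubleMarkov

theorem stmt16 {𝒳 𝒴 γ : Type*} [Fintype 𝒳] [Fintype 𝒴] [Fintype γ]
    (μ : 𝒳 × 𝒴 → ℝ) (hμ : IsPMF μ)
    (f : 𝒳 ⊕ 𝒴 → γ)
    (hf : ∀ a b, f a = f b ↔ Relation.EqvGen (edge μ) a b) :
    (((0 : ℝ), (0 : ℝ), (0 : ℝ)) ∈ closure (KRegion μ) ↔
      ∃ (m : ℕ) (ν : 𝒳 × 𝒴 × Fin m → ℝ),
        IsPMF ν ∧
        (∀ ab, prob ν (fun ω => (ω.1, ω.2.1)) ab = μ ab) ∧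
        cmi ν (fun ω => ω.2.2) (fun ω => ω.2.1) (fun ω => ω.1) = 0 ∧
        cmi ν (fun ω => ω.2.2) (fun ω => ω.1) (fun ω => ω.2.1) = 0 ∧
        cmi ν (fun ω => ω.1) (fun ω => ω.2.1) (fun ω => ω.2.2) = 0) ∧
    (((0 : ℝ), (0 : ℝ), (0 : ℝ)) ∈ closure (KRegion μ) →
      cmi μ (fun ω => ω.1) (fun ω => ω.2) (fun ω => f (Sum.inl ω.1)) = 0) := by
  refine ⟨⟨exists_of_mem_closure hμ, ?_⟩, fun h => ?_⟩
  · rintro ⟨m, ν, hν, hμν, hl, hr, hi⟩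
    exact subset_closure
      ⟨m, ν, hν, hμν, hl.le, hr.le, hi.le, le_rfl, le_rfl, le_rfl⟩
  · obtain ⟨m, ν, hν, hμν, hl, hr, hi⟩ := exists_of_mem_closure hμ h
    exact cmi_component_eq_zero hμ hf hν hμν hl hr hi
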